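/- arXiv:0807.4103 — 3 statements merged into one kernel-verified Lean document; each statement's English description precedes it below -/
import Mathlib

section
/- Let n ∈ ℕ, let A ⊆ ℝ, let a ∈ ℝ with a ∉ Cl A (the closure of A), and let f : A ∪ {a} → ℝ. If for every k ∈ {1, …, n} the k-point divided differences [x₁, …, x_k; f] are bounded as x₁, …, x_k range over distinct points of A, then for every k ∈ {1, …, n} the k-point divided differences [x₁, …, x_k; f] remain bounded as x₁, …, x_k range over distinct points of A ∪ {a}. -/
/-- Divided differences of `f` at the points of a list, defined recursively:
`[x₁; f] = f x₁` and
`[x₁, …, x_{k+1}; f] = ([x₂, …, x_{k+1}; f] − [x₁, …, x_k; f]) / (x_{k+1} − x₁)`. -/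
noncomputable def divDiff (f : ℝ → ℝ) : List ℝ → ℝ
  | [] => 0
  | [x] => f x
  | x :: y :: l =>
      (divDiff f (y :: l) - divDiff f (x :: (y :: l).dropLast)) /
        ((y :: l).getLast (List.cons_ne_nil y l) - x)
termination_by l => l.length
decreasing_by
  all_goals simp [List.length_dropLast]

/-- A function `f` is `n`-convex on a set `I` if all its `(n+2)`-point divided
differences at distinct points of `I` are nonnegative. -/
def NConvexOn (n : ℕ) (I : Set ℝ) (f : ℝ → ℝ) : Prop :=
  ∀ l : List ℝ, l.length = n + 2 → l.Nodup → (∀ x ∈ l, x ∈ I) → 0 ≤ divDiff f l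

theorem divDiff_cons_append_singleton (f : ℝ → ℝ) (x z : ℝ) (m : List ℝ) :
    divDiff f (x :: (m ++ [z])) = (divDiff f (m ++ [z]) - divDiff f (x :: m)) / (z - x) := by
  cases m with
  | nil => simp [divDiff]
  | cons y m =>
    simp only [List.cons_append]
    rw [divDiff]
    have h : (y :: (m ++ [z])).dropLast = y :: m := List.dropLast_concat (l₁ := y :: m)
    simp [h]

/-- The explicit, manifestly symmetric form of the divided difference at the points of a
finite set. -/
noncomputable def symmDivDiff (f : ℝ → ℝ) (s : Finset ℝ) : ℝ :=
  ∑ x ∈ s, f x * ∏ y ∈ s.erase x, (x - y)⁻¹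

theorem symmDivDiff_insert (f : ℝ → ℝ) {a : ℝ} {s : Finset ℝ} (ha : a ∉ s) :
    symmDivDiff f (insert a s) = f a * ∏ y ∈ s, (a - y)⁻¹ +
      ∑ x ∈ s, f x * ((x - a)⁻¹ * ∏ y ∈ s.erase x, (x - y)⁻¹) := by
  rw [symmDivDiff, Finset.sum_insert ha, Finset.erase_insert ha]
  congr 1
  refine Finset.sum_congr rfl fun x hx => ?_
  have hax : a ≠ x := fun h => ha (h ▸ hx)
  rw [Finset.erase_insert_of_ne hax, Finset.prod_insert (fun h => ha (Finset.mem_of_mem_erase h))]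

theorem symmDivDiff_insert_insert (f : ℝ → ℝ) {a b : ℝ} {t : Finset ℝ} (hab : a ≠ b)
    (ha : a ∉ t) (hb : b ∉ t) :
    symmDivDiff f (insert a (insert b t)) =
      (symmDivDiff f (insert b t) - symmDivDiff f (insert a t)) / (b - a) := by
  have hba : b - a ≠ 0 := sub_ne_zero.mpr hab.symm
  have hab' : a - b ≠ 0 := sub_ne_zero.mpr hab
  have hat : a ∉ insert b t := by simp [hab, ha]
  have hsum : ∑ x ∈ t, f x * ((x - a)⁻¹ * ∏ y ∈ (insert b t).erase x, (x - y)⁻¹) =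
      (∑ x ∈ t, f x * ((x - b)⁻¹ * ∏ y ∈ t.erase x, (x - y)⁻¹) -
        ∑ x ∈ t, f x * ((x - a)⁻¹ * ∏ y ∈ t.erase x, (x - y)⁻¹)) / (b - a) := by
    rw [← Finset.sum_sub_distrib, Finset.sum_div]
    refine Finset.sum_congr rfl fun x hx => ?_
    have hbx : b ≠ x := fun h => hb (h ▸ hx)
    have hxa : x - a ≠ 0 := sub_ne_zero.mpr fun h => ha (h ▸ hx)
    have hxb : x - b ≠ 0 := sub_ne_zero.mpr hbx.symm
    rw [Finset.erase_insert_of_ne hbx,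
      Finset.prod_insert (fun h => hb (Finset.mem_of_mem_erase h))]
    generalize ∏ y ∈ t.erase x, (x - y)⁻¹ = p
    field_simp
    ring
  rw [symmDivDiff_insert f hat, Finset.prod_insert hb, Finset.sum_insert hb,
    Finset.erase_insert hb, hsum, symmDivDiff_insert f hb, symmDivDiff_insert f ha]
  generalize ∏ y ∈ t, (a - y)⁻¹ = p
  generalize ∏ y ∈ t, (b - y)⁻¹ = q
  rw [← neg_sub b a, inv_neg]
  field_simp
  ring

theorem divDiff_eq_symmDivDiff (f : ℝ → ℝ) (l : List ℝ) (hl : l.Nodup) :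
    divDiff f l = symmDivDiff f l.toFinset := by
  induction hn : l.length using Nat.strong_induction_on generalizing l with
  | _ n ih =>
  rcases l with _ | ⟨x, l⟩
  · simp [divDiff, symmDivDiff]
  rcases List.eq_nil_or_concat' l with rfl | ⟨m, z, rfl⟩
  · simp [divDiff, symmDivDiff]
  have hz : (m ++ [z]).toFinset = insert z m.toFinset := by ext; simp
  obtain ⟨hx, hmz⟩ := List.nodup_cons.mp hl
  have hxm : x ∉ m := fun h => hx (by simp [h])
  have hxz : x ≠ z := fun h => hx (by simp [h])
  have hm : m.Nodup := hmz.sublist (List.sublist_append_left m [z])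
  have hzm : z ∉ m := by
    intro h
    exact (List.nodup_append.mp hmz).2.2 z h z (by simp) rfl
  simp only [List.length_cons, List.length_append, List.length_nil] at hn
  rw [divDiff_cons_append_singleton, ih (m.length + 1) (by omega) _ hmz (by simp),
    ih (m.length + 1) (by omega) (x :: m) (List.nodup_cons.mpr ⟨hxm, hm⟩) (by simp),
    List.toFinset_cons, List.toFinset_cons, hz,
    symmDivDiff_insert_insert f hxz (by simpa using hxm) (by simpa using hzm)]

theorem divDiff_perm (f : ℝ → ℝ) {l l' : List ℝ} (hl : l.Nodup) (h : l.Perm l') :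
    divDiff f l = divDiff f l' := by
  rw [divDiff_eq_symmDivDiff f l hl, divDiff_eq_symmDivDiff f l' (h.nodup_iff.mp hl),
    List.toFinset_eq_of_perm _ _ h]

theorem divDiff_cons_bounded {n : ℕ} {A : Set ℝ} {a : ℝ} (ha : a ∉ closure A) {f : ℝ → ℝ}
    (hbd : ∀ k : ℕ, 1 ≤ k → k ≤ n → ∃ M : ℝ, ∀ l : List ℝ,
      l.length = k → l.Nodup → (∀ x ∈ l, x ∈ A) → |divDiff f l| ≤ M)
    (k : ℕ) (hk : k ≤ n) :
    ∃ M : ℝ, ∀ l : List ℝ, l.length = k → l.Nodup → (∀ x ∈ l, x ∈ A) →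
      |divDiff f (a :: l)| ≤ M := by
  obtain ⟨δ, hδ, hA⟩ : ∃ δ > 0, ∀ x ∈ A, δ ≤ |x - a| := by
    rw [Metric.mem_closure_iff] at ha
    push Not at ha
    simpa [dist_comm a, Real.dist_eq] using ha
  induction k with
  | zero =>
    refine ⟨|f a|, fun l hl _ _ => ?_⟩
    rw [List.length_eq_zero_iff.mp hl, divDiff]
  | succ k ih =>
    obtain ⟨M, hM⟩ := ih (by omega)
    obtain ⟨N, hN⟩ := hbd (k + 1) (by omega) hk
    refine ⟨(N + M) / δ, fun l hl hnd hlA => ?_⟩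
    rcases List.eq_nil_or_concat' l with rfl | ⟨m, z, rfl⟩
    · simp at hl
    have hb := hN _ hl hnd hlA
    have hb' := hM m (by simpa using hl) (hnd.sublist (List.sublist_append_left m [z]))
      fun x hx => hlA x (by simp [hx])
    rw [divDiff_cons_append_singleton, abs_div]
    have hnum := (abs_sub _ _).trans (add_le_add hb hb')
    exact div_le_div₀ ((abs_nonneg _).trans hnum) hnum hδ (hA z (hlA z (by simp)))

/-- Lemma 1: if all `k`-point divided differences of `f` (for `1 ≤ k ≤ n`) are
bounded on `A`, and `a ∉ closure A`, then they remain bounded on `A ∪ {a}`. -/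
theorem divDiff_bounded_of_bounded_closure
    (n : ℕ) (A : Set ℝ) (a : ℝ) (ha : a ∉ closure A) (f : ℝ → ℝ)
    (hbd : ∀ k : ℕ, 1 ≤ k → k ≤ n → ∃ M : ℝ, ∀ l : List ℝ,
      l.length = k → l.Nodup → (∀ x ∈ l, x ∈ A) → |divDiff f l| ≤ M) :
    ∀ k : ℕ, 1 ≤ k → k ≤ n → ∃ M : ℝ, ∀ l : List ℝ,
      l.length = k → l.Nodup → (∀ x ∈ l, x ∈ A ∪ {a}) → |divDiff f l| ≤ M := by
  intro k hk hkn
  obtain ⟨M, hM⟩ := hbd k hk hkn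
  obtain ⟨N, hN⟩ := divDiff_cons_bounded ha hbd (k - 1) (by omega)
  refine ⟨max M N, fun l hl hnd hlA => ?_⟩
  by_cases hal : a ∈ l
  · have hp := List.perm_cons_erase hal
    rw [divDiff_perm f hnd hp]
    refine (hN (l.erase a) (by rw [List.length_erase_of_mem hal, hl]) (hnd.erase a)
      fun x hx => ?_).trans (le_max_right _ _)
    obtain ⟨hxa, hxl⟩ := hnd.mem_erase_iff.mp hx
    exact (hlA x hxl).resolve_right hxa
  · refine (hM l hl hnd fun x hx => (hlA x hx).resolve_right ?_).trans (le_max_left _ _)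
    rintro rfl
    exact hal hx
end

section
/- Let n ∈ ℕ and let f : I → ℝ be an n-convex function on an interval I ⊆ ℝ. Fix k ∈ ℕ with k ≤ n, take points x₁ < x₂ < … < x_k in I, and assign to each point x_j a multiplicity l_j ∈ ℕ, l_j ≥ 1, such that l₁ + … + l_k = n + 1, and such that l₁ = 1 if x₁ = inf I and l_k = 1 if x_k = sup I. Denote I₀ = (−∞, x₁), I_j = (x_j, x_{j+1}) for j = 1, …, k−1, and I_k = (x_k, ∞). Then there exists a polynomial p ∈ Πₙ such that p(x_j) = f(x_j) for j = 1, …, k, and: (−1)^{n+1}(f(x) − p(x)) ≥ 0 for all x ∈ I₀ ∩ I; (−1)^{n+1−(l₁+…+l_j)}(f(x) − p(x)) ≥ 0 for all x ∈ I_j, j = 1, …, k−1; and f(x) − p(x) ≥ 0 for all x ∈ I_k ∩ I. -/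
open Polynomial Filter Topology

/-- The divided difference of `f` at the points of a finite set `S`, as the coefficient of
`X ^ (#S - 1)` in the Lagrange interpolation polynomial. -/
noncomputable def finsetDivDiff (f : ℝ → ℝ) (S : Finset ℝ) : ℝ :=
  (Lagrange.interpolate S id f).coeff (S.card - 1)

theorem degree_interpolate_id_lt (f : ℝ → ℝ) (S : Finset ℝ) :
    (Lagrange.interpolate S id f).degree < S.card :=
  Lagrange.degree_interpolate_lt _ Function.injective_id.injOn

theorem natDegree_interpolate_id_le (f : ℝ → ℝ) {S : Finset ℝ} {n : ℕ} (hS : S.card = n + 1) :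
    (Lagrange.interpolate S id f).natDegree ≤ n := by
  have h := degree_interpolate_id_lt f S
  rw [hS, degree_lt_iff_coeff_zero] at h
  exact natDegree_le_iff_coeff_eq_zero.2 h

theorem eval_interpolate_id (f : ℝ → ℝ) {S : Finset ℝ} {a : ℝ} (ha : a ∈ S) :
    (Lagrange.interpolate S id f).eval a = f a :=
  Lagrange.eval_interpolate_at_node (v := id) f Function.injective_id.injOn ha

/-- Newton's formula for adding one interpolation node. -/
theorem interpolate_insert_eq (f : ℝ → ℝ) {S : Finset ℝ} {a : ℝ} (ha : a ∉ S) :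
    Lagrange.interpolate (insert a S) id f =
      Lagrange.interpolate S id f + C (finsetDivDiff f (insert a S)) * Lagrange.nodal S id := by
  rw [← sub_eq_iff_eq_add']
  refine eq_of_degree_sub_lt_of_eval_finset_eq S ?_ fun b hb => ?_
  · rw [degree_lt_iff_coeff_zero]
    intro m hm
    have h₁ : (Lagrange.interpolate S id f).coeff m = 0 :=
      coeff_eq_zero_of_degree_lt
        ((degree_interpolate_id_lt f S).trans_le (by exact_mod_cast hm))
    rcases hm.eq_or_lt with rfl | hm
    · have h₂ : (Lagrange.nodal S (id : ℝ → ℝ)).coeff S.card = 1 := by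
        have := (Lagrange.nodal_monic (s := S) (v := (id : ℝ → ℝ))).coeff_natDegree
        rwa [Lagrange.natDegree_nodal] at this
      simp only [coeff_sub, coeff_C_mul, h₁, h₂, finsetDivDiff, Finset.card_insert_of_notMem ha]
      simp
    · have h₂ : (Lagrange.nodal S (id : ℝ → ℝ)).coeff m = 0 :=
        coeff_eq_zero_of_natDegree_lt (by rwa [Lagrange.natDegree_nodal])
      have h₃ : (Lagrange.interpolate (insert a S) id f).coeff m = 0 := by
        refine coeff_eq_zero_of_degree_lt ((degree_interpolate_id_lt f _).trans_le ?_)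
        rw [Finset.card_insert_of_notMem ha]
        exact_mod_cast hm
      simp only [coeff_sub, coeff_C_mul, h₁, h₂, h₃]
      simp
  · have h₀ : (Lagrange.nodal S (id : ℝ → ℝ)).eval b = 0 :=
      Lagrange.eval_nodal_at_node (v := id) hb
    simp only [eval_sub, eval_mul, h₀, eval_interpolate_id f hb,
      eval_interpolate_id f (Finset.mem_insert_of_mem hb)]
    simp

/-- The interpolation error in terms of a divided difference. -/
theorem sub_eval_interpolate (f : ℝ → ℝ) {S : Finset ℝ} {a : ℝ} (ha : a ∉ S) :
    f a - (Lagrange.interpolate S id f).eval a =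
      finsetDivDiff f (insert a S) * ∏ s ∈ S, (a - s) := by
  have h := congrArg (eval a) (interpolate_insert_eq f ha)
  rw [eval_interpolate_id f (Finset.mem_insert_self a S), eval_add, eval_mul, eval_C,
    Lagrange.eval_nodal] at h
  simp only [id] at h
  linarith

theorem finsetDivDiff_sub (f : ℝ → ℝ) {T : Finset ℝ} {a b : ℝ} (ha : a ∉ T) (hb : b ∉ T)
    (hab : a ≠ b) :
    finsetDivDiff f (insert b T) - finsetDivDiff f (insert a T) =
      (b - a) * finsetDivDiff f (insert a (insert b T)) := by
  have h₁ := interpolate_insert_eq f (S := insert b T) (a := a) (by simp [ha, hab])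
  have h₂ := interpolate_insert_eq f (S := insert a T) (a := b) (by simp [hb, hab.symm])
  rw [interpolate_insert_eq f hb, Lagrange.nodal_insert_eq_nodal hb] at h₁
  rw [interpolate_insert_eq f ha, Lagrange.nodal_insert_eq_nodal ha,
    Finset.insert_comm] at h₂
  have h₃ : (C (finsetDivDiff f (insert b T)) +
        C (finsetDivDiff f (insert a (insert b T))) * (X - C b)) * Lagrange.nodal T id =
      (C (finsetDivDiff f (insert a T)) +
        C (finsetDivDiff f (insert a (insert b T))) * (X - C a)) * Lagrange.nodal T id := by
    simp only [id] at h₁ h₂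
    linear_combination h₂ - h₁
  have h₄ := congrArg (eval 0) (mul_right_cancel₀ Lagrange.nodal_ne_zero h₃)
  simp only [eval_add, eval_mul, eval_C, eval_sub, eval_X] at h₄
  linarith

theorem divDiff_eq_finsetDivDiff (f : ℝ → ℝ) :
    ∀ l : List ℝ, l ≠ [] → l.Nodup → divDiff f l = finsetDivDiff f l.toFinset
  | [], h, _ => absurd rfl h
  | [x], _, _ => by
    simp [divDiff, finsetDivDiff]
  | x :: y :: l, _, hl => by
    have hne : y :: l ≠ [] := List.cons_ne_nil y l
    have hsplit : (y :: l).dropLast ++ [(y :: l).getLast hne] = y :: l :=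
      List.dropLast_append_getLast hne
    have ih₁ := divDiff_eq_finsetDivDiff f (y :: l) hne (List.nodup_cons.1 hl).2
    have hl' := hl
    have hdec : (x :: (y :: l).dropLast).length < (x :: y :: l).length := by simp
    rw [divDiff]
    rw [← hsplit] at hl'
    rw [ih₁]
    conv_rhs => rw [← hsplit]
    conv_lhs => enter [1, 1]; rw [← hsplit]
    generalize (y :: l).getLast hne = b at *
    generalize (y :: l).dropLast = m at *
    have hnd : (x :: m).Nodup :=
      hl'.sublist (List.Sublist.cons_cons x (List.sublist_append_left m [b]))
    have ih₂ := divDiff_eq_finsetDivDiff f (x :: m) (List.cons_ne_nil x m) hnd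
    rw [List.nodup_cons, List.nodup_append] at hl'
    have hx : x ∉ m := fun h => hl'.1 (by simp [h])
    have hb : b ∉ m := fun h => hl'.2.2.2 b h b (by simp) rfl
    have hxb : x ≠ b := fun h => hl'.1 (by simp [h])
    have hmb : (m ++ [b]).toFinset = insert b m.toFinset := by
      ext; simp
    rw [ih₂, List.toFinset_cons, List.toFinset_cons, hmb,
      finsetDivDiff_sub f (by simpa using hx) (by simpa using hb) hxb]
    exact mul_div_cancel_left₀ _ (sub_ne_zero.2 hxb.symm)
termination_by l => l.length

theorem NConvexOn.finsetDivDiff_nonneg {n : ℕ} {I : Set ℝ} {f : ℝ → ℝ} (hf : NConvexOn n I f)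
    {S : Finset ℝ} (hS : ↑S ⊆ I) (hcard : S.card = n + 2) : 0 ≤ finsetDivDiff f S := by
  have h := hf S.toList (by simpa using hcard) S.nodup_toList fun s hs => hS (by simpa using hs)
  rwa [divDiff_eq_finsetDivDiff f _ (by
    rw [Ne, ← List.length_eq_zero_iff, Finset.length_toList]; omega) S.nodup_toList,
    Finset.toList_toFinset] at h

/-- Divided differences of order `n` of an `n`-convex function are monotone in the nodes. -/
theorem NConvexOn.finsetDivDiff_le {n : ℕ} {I : Set ℝ} {f : ℝ → ℝ} (hf : NConvexOn n I f)
    {S U : Finset ℝ} (hS : ↑S ⊆ I) (hU : ↑U ⊆ I) (hSc : S.card = n + 1) (hUc : U.card = n + 1)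
    (hSU : ∀ s ∈ S, s ∉ U → ∀ u ∈ U, u ∉ S → s < u) :
    finsetDivDiff f S ≤ finsetDivDiff f U := by
  induction hm : (S \ U).card generalizing S with
  | zero =>
    rw [Finset.card_eq_zero, Finset.sdiff_eq_empty_iff_subset] at hm
    rw [Finset.eq_of_subset_of_card_le hm (by omega)]
  | succ m ih =>
    obtain ⟨a, ha⟩ : (S \ U).Nonempty := Finset.card_pos.1 (by omega)
    obtain ⟨b, hb⟩ : (U \ S).Nonempty := by
      rw [← Finset.card_pos, ← Finset.card_sdiff_comm (hSc.trans hUc.symm)]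
      omega
    rw [Finset.mem_sdiff] at ha hb
    have hab : a < b := hSU a ha.1 ha.2 b hb.1 hb.2
    have hbT : b ∉ S.erase a := fun h => hb.2 (Finset.mem_of_mem_erase h)
    have hSins : insert a (S.erase a) = S := Finset.insert_erase ha.1
    have hcardT : (S.erase a).card = n := by
      rw [Finset.card_erase_of_mem ha.1, hSc]; rfl
    have hsub : (↑(insert b (S.erase a)) : Set ℝ) ⊆ I := by
      intro s hs
      simp only [Finset.coe_insert, Set.mem_insert_iff, Finset.mem_coe, Finset.mem_erase] at hs
      rcases hs with rfl | hs
      · exact hU hb.1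
      · exact hS hs.2
    have hstep : finsetDivDiff f S ≤ finsetDivDiff f (insert b (S.erase a)) := by
      have h := finsetDivDiff_sub f (Finset.notMem_erase a S) hbT hab.ne
      have h₀ : 0 ≤ finsetDivDiff f (insert a (insert b (S.erase a))) := by
        refine hf.finsetDivDiff_nonneg ?_ ?_
        · rw [Finset.coe_insert]
          exact Set.insert_subset (hS ha.1) hsub
        · rw [Finset.card_insert_of_notMem (by simp [hab.ne]),
            Finset.card_insert_of_notMem hbT, hcardT]
      rw [hSins] at h
      nlinarith [mul_nonneg (sub_pos.2 hab).le h₀]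
    refine hstep.trans (ih hsub ?_ ?_ ?_)
    · rw [Finset.card_insert_of_notMem hbT, hcardT]
    · intro s hs hsU u hu huS
      simp only [Finset.mem_insert, Finset.mem_erase] at hs huS
      rcases hs with rfl | hs
      · exact absurd hb.1 hsU
      · exact hSU s hs.2 hsU u hu fun h => huS (Or.inr ⟨fun h' => ha.2 (h' ▸ hu), h⟩)
    · have : insert b (S.erase a) \ U = (S \ U).erase a := by
        rw [Finset.insert_sdiff_of_mem _ hb.1, Finset.erase_sdiff_comm]
      rw [this, Finset.card_erase_of_mem (by simpa using ha), hm]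
      rfl

/-- Divided differences of order `n` of an `n`-convex function are bounded as long as the nodes
stay away from two points `A` and `B`, which may themselves be nodes. -/
theorem NConvexOn.exists_abs_finsetDivDiff_le {n : ℕ} {I : Set ℝ} {f : ℝ → ℝ}
    (hf : NConvexOn n I f) (hI : I.OrdConnected) {A B c d : ℝ} (hA : A ∈ I) (hB : B ∈ I)
    (hAc : A < c) (hcd : c < d) (hdB : d < B) :
    ∃ M : ℝ, ∀ S : Finset ℝ, S.card = n + 1 →
      (∀ s ∈ S, (s = A ∨ c < s) ∧ (s = B ∨ s < d)) → |finsetDivDiff f S| ≤ M := by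
  obtain ⟨L, hL, hLc⟩ := (Set.Ioo_infinite hAc).exists_subset_card_eq n
  obtain ⟨U, hU, hUc⟩ := (Set.Ioo_infinite hdB).exists_subset_card_eq n
  have hmem : ∀ s, A ≤ s → s ≤ B → s ∈ I := fun s h₁ h₂ => hI.out hA hB ⟨h₁, h₂⟩
  refine ⟨max (-finsetDivDiff f (insert A L)) (finsetDivDiff f (insert B U)),
    fun S hSc hS => ?_⟩
  have hSI : ↑S ⊆ I := by
    intro s hs
    obtain ⟨h₁, h₂⟩ := hS s hs
    apply hmem
    · rcases h₁ with h₁ | h₁ <;> linarith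
    · rcases h₂ with h₂ | h₂ <;> linarith
  have hlow : finsetDivDiff f (insert A L) ≤ finsetDivDiff f S := by
    refine hf.finsetDivDiff_le ?_ hSI ?_ hSc ?_
    · intro s hs
      rcases Finset.mem_insert.1 (Finset.mem_coe.1 hs) with rfl | hs
      · exact hA
      · have := hL hs
        exact hmem s this.1.le (by linarith [this.2])
    · rw [Finset.card_insert_of_notMem fun h => lt_irrefl A (hL h).1, hLc]
    · intro s hs _ u hu huL
      have hu' : c < u := (hS u hu).1.resolve_left fun h => huL (by simp [h])
      rcases Finset.mem_insert.1 hs with rfl | hs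
      · exact hAc.trans hu'
      · exact (hL hs).2.trans hu'
  have hup : finsetDivDiff f S ≤ finsetDivDiff f (insert B U) := by
    refine hf.finsetDivDiff_le hSI ?_ hSc ?_ ?_
    · intro s hs
      rcases Finset.mem_insert.1 (Finset.mem_coe.1 hs) with rfl | hs
      · exact hB
      · have := hU hs
        exact hmem s (by linarith [this.1]) this.2.le
    · rw [Finset.card_insert_of_notMem fun h => lt_irrefl B (hU h).2, hUc]
    · intro s hs hsU u hu _
      have hs' : s < d := (hS s hs).2.resolve_left fun h => hsU (by simp [h])
      rcases Finset.mem_insert.1 hu with rfl | hu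
      · exact hs'.trans hdB
      · exact hs'.trans (hU hu).1
  rw [abs_le]
  constructor
  · linarith [le_max_left (-finsetDivDiff f (insert A L)) (finsetDivDiff f (insert B U))]
  · exact hup.trans (le_max_right _ _)

/-- The sign of `∏ j, (y - x j) ^ l j` is determined by the roots to the right of `y`. -/
theorem prod_sub_pow_sign {ι : Type*} [Fintype ι] (x : ι → ℝ) (l : ι → ℕ) {y : ℝ}
    (hy : ∀ j, y ≠ x j) :
    0 < (-1 : ℝ) ^ (∑ j with y < x j, l j) * ∏ j, (y - x j) ^ l j := by
  rw [← Finset.prod_pow_eq_pow_sum, Finset.prod_filter, ← Finset.prod_mul_distrib]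
  refine Finset.prod_pos fun j _ => ?_
  split_ifs with h
  · rw [← mul_pow]
    exact pow_pos (by linarith) _
  · rw [one_mul]
    exact pow_pos (sub_pos.2 (lt_of_le_of_ne (not_lt.1 h) (hy j).symm)) _

/-- The `l j` equispaced nodes of step `ε` starting from `x j`, for each `j`. -/
def clusterNode {ι : Type*} (x : ι → ℝ) (l : ι → ℕ) (ε : ℝ) (q : Σ j, Fin (l j)) : ℝ :=
  x q.1 + (q.2 : ℕ) * ε

theorem tendsto_clusterNode {ι : Type*} (x : ι → ℝ) (l : ι → ℕ) (q : Σ j, Fin (l j)) :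
    Tendsto (fun ε => clusterNode x l ε q) (𝓝[>] 0) (𝓝 (x q.1)) := by
  have : Continuous fun ε => clusterNode x l ε q := by unfold clusterNode; fun_prop
  have h := (this.tendsto 0).mono_left (nhdsWithin_le_nhds (s := Set.Ioi 0))
  simpa [clusterNode] using h

theorem eventually_injective_clusterNode {ι : Type*} [Finite ι] {x : ι → ℝ}
    (hx : Function.Injective x) (l : ι → ℕ) :
    ∀ᶠ ε in 𝓝[>] 0, Function.Injective (clusterNode x l ε) := by
  have key : ∀ p q : Σ j, Fin (l j), p ≠ q →
      ∀ᶠ ε in 𝓝[>] 0, clusterNode x l ε p ≠ clusterNode x l ε q := by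
    rintro ⟨i, a⟩ ⟨j, b⟩ hpq
    by_cases hij : i = j
    · subst hij
      filter_upwards [self_mem_nhdsWithin] with ε (hε : 0 < ε) h
      refine hpq ?_
      have : ((a : ℕ) : ℝ) = (b : ℕ) := mul_right_cancel₀ hε.ne' (add_left_cancel h)
      rw [Fin.ext (Nat.cast_injective this)]
    · filter_upwards [((tendsto_clusterNode x l ⟨i, a⟩).sub
        (tendsto_clusterNode x l ⟨j, b⟩)).eventually_ne (sub_ne_zero.2 (hx.ne hij))] with ε h
      exact sub_ne_zero.1 h
  have hall : ∀ᶠ ε in 𝓝[>] 0, ∀ p q : Σ j, Fin (l j), p ≠ q →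
      clusterNode x l ε p ≠ clusterNode x l ε q := by
    simpa only [eventually_all] using key
  filter_upwards [hall] with ε h p q hpq
  by_contra hne
  exact h p q hne hpq

theorem tendsto_prod_sub_clusterNode {ι : Type*} [Fintype ι] (x : ι → ℝ) (l : ι → ℕ) (y : ℝ) :
    Tendsto (fun ε => ∏ q, (y - clusterNode x l ε q)) (𝓝[>] 0) (𝓝 (∏ j, (y - x j) ^ l j)) := by
  have h : Tendsto (fun ε => ∏ q, (y - clusterNode x l ε q)) (𝓝[>] 0)
      (𝓝 (∏ q : Σ j, Fin (l j), (y - x q.1))) :=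
    tendsto_finsetProd _ fun q _ => tendsto_const_nhds.sub (tendsto_clusterNode x l q)
  simpa [Fintype.prod_sigma] using h

theorem eventually_clusterNode_mem {ι : Type*} [Finite ι] {x : ι → ℝ} {l : ι → ℕ} {A B c d : ℝ}
    (hc : ∀ j, x j = A ∨ c < x j) (hd : ∀ j, x j = B ∨ x j < d)
    (hlA : ∀ j, x j = A → l j = 1) (hlB : ∀ j, x j = B → l j = 1) :
    ∀ᶠ ε in 𝓝[>] 0, ∀ q, (clusterNode x l ε q = A ∨ c < clusterNode x l ε q) ∧
      (clusterNode x l ε q = B ∨ clusterNode x l ε q < d) := by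
  have hone : ∀ q : Σ j, Fin (l j), l q.1 = 1 → ∀ ε, clusterNode x l ε q = x q.1 := by
    intro q hq ε
    have : (q.2 : ℕ) = 0 := by have := q.2.isLt; omega
    simp [clusterNode, this]
  refine eventually_all.2 fun q => Filter.Eventually.and ?_ ?_
  · rcases hc q.1 with h | h
    · exact Eventually.of_forall fun ε => Or.inl (by rw [hone q (hlA _ h), h])
    · exact ((tendsto_clusterNode x l q).eventually_const_lt h).mono fun _ => Or.inr
  · rcases hd q.1 with h | h
    · exact Eventually.of_forall fun ε => Or.inl (by rw [hone q (hlB _ h), h])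
    · exact ((tendsto_clusterNode x l q).eventually_lt_const h).mono fun _ => Or.inr

/-- If polynomials of degree at most `n` are eventually bounded at each point of an infinite set,
then they converge pointwise to such a polynomial along an ultrafilter. -/
theorem exists_tendsto_eval_of_bounded {α : Type*} (F : Ultrafilter α) {n : ℕ} {P : α → ℝ[X]}
    (hP : ∀ᶠ a in F, (P a).natDegree ≤ n) {Y : Set ℝ} (hY : Y.Infinite)
    (hb : ∀ y ∈ Y, ∃ M : ℝ, ∀ᶠ a in F, |(P a).eval y| ≤ M) :
    ∃ p : ℝ[X], p.natDegree ≤ n ∧ ∀ z, Tendsto (fun a => (P a).eval z) F (𝓝 (p.eval z)) := by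
  obtain ⟨N, hN, hNc⟩ := hY.exists_subset_card_eq (n + 1)
  have hlim : ∀ y : ℝ, ∃ v, y ∈ N → Tendsto (fun a => (P a).eval y) F (𝓝 v) := by
    intro y
    by_cases hy : y ∈ N
    · obtain ⟨M, hM⟩ := hb y (hN hy)
      obtain ⟨v, -, hv⟩ := (isCompact_Icc (a := -M) (b := M)).ultrafilter_le_nhds
        (F.map fun a => (P a).eval y)
        (le_principal_iff.2 (hM.mono fun a ha => abs_le.1 ha))
      exact ⟨v, fun _ => hv⟩
    · exact ⟨0, fun h => absurd h hy⟩
  choose v hv using hlim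
  refine ⟨Lagrange.interpolate N id v, ?_, fun z => ?_⟩
  · exact natDegree_interpolate_id_le v hNc
  · have h : Tendsto (fun a => ∑ y ∈ N, (P a).eval y * (Lagrange.basis N id y).eval z) F
        (𝓝 (∑ y ∈ N, v y * (Lagrange.basis N id y).eval z)) :=
      tendsto_finsetSum _ fun y hy => (hv y hy).mul_const _
    have hval : (Lagrange.interpolate N id v).eval z =
        ∑ y ∈ N, v y * (Lagrange.basis N id y).eval z := by
      simp [Lagrange.interpolate_apply, eval_finsetSum]
    rw [hval]
    refine h.congr' (hP.mono fun a ha => ?_)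
    have hdeg : (P a).degree < N.card := by
      rw [hNc]
      exact lt_of_le_of_lt degree_le_natDegree (by exact_mod_cast Nat.lt_succ_of_le ha)
    beta_reduce
    conv_rhs => rw [Lagrange.eq_interpolate (v := id) Function.injective_id.injOn hdeg]
    simp [Lagrange.interpolate_apply, eval_finsetSum]

/-- The attaching method, with the sign conditions expressed through `∏ j, (y - x j) ^ l j`. -/
theorem NConvexOn.exists_attaching_polynomial {ι : Type*} [Fintype ι] [Nonempty ι] {n : ℕ}
    {I : Set ℝ} {f : ℝ → ℝ} (hf : NConvexOn n I f) (hI : I.OrdConnected) {x : ι → ℝ}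
    (hx : Function.Injective x) {l : ι → ℕ} (hl : ∀ j, 1 ≤ l j) (hlsum : ∑ j, l j = n + 1)
    {A B : ℝ} (hA : A ∈ I) (hB : B ∈ I) (hAB : A < B) (hAx : ∀ j, A ≤ x j) (hxB : ∀ j, x j ≤ B)
    (hlA : ∀ j, x j = A → l j = 1) (hlB : ∀ j, x j = B → l j = 1) :
    ∃ p : ℝ[X], p.natDegree ≤ n ∧ (∀ j, p.eval (x j) = f (x j)) ∧
      ∀ y ∈ I, (∀ j, y ≠ x j) → 0 ≤ (f y - p.eval y) * ∏ j, (y - x j) ^ l j := by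
  obtain ⟨c, ⟨hAc, hcm⟩, hc⟩ : ∃ c, c ∈ Set.Ioo A ((A + B) / 2) ∧ ∀ j, x j = A ∨ c < x j := by
    have h₁ : ∀ᶠ c in 𝓝[>] A, ∀ j, x j = A ∨ c < x j := by
      refine eventually_all.2 fun j => ?_
      rcases (hAx j).eq_or_lt with h | h
      · exact Eventually.of_forall fun _ => Or.inl h.symm
      · filter_upwards [Ioo_mem_nhdsGT h] with c hc using Or.inr hc.2
    exact (Filter.Eventually.and (Ioo_mem_nhdsGT (by linarith)) h₁).exists
  obtain ⟨d, ⟨hmd, hdB⟩, hd⟩ : ∃ d, d ∈ Set.Ioo ((A + B) / 2) B ∧ ∀ j, x j = B ∨ x j < d := by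
    have h₁ : ∀ᶠ d in 𝓝[<] B, ∀ j, x j = B ∨ x j < d := by
      refine eventually_all.2 fun j => ?_
      rcases (hxB j).eq_or_lt with h | h
      · exact Eventually.of_forall fun _ => Or.inl h
      · filter_upwards [Ioo_mem_nhdsLT h] with d hd using Or.inr hd.1
    exact (Filter.Eventually.and (Ioo_mem_nhdsLT (by linarith)) h₁).exists
  have hcd : c < d := hcm.trans hmd
  obtain ⟨M, hM⟩ := hf.exists_abs_finsetDivDiff_le hI hA hB hAc hcd hdB
  let S : ℝ → Finset ℝ := fun ε => Finset.univ.image (clusterNode x l ε)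
  let P : ℝ → ℝ[X] := fun ε => Lagrange.interpolate (S ε) id f
  have hinj := eventually_injective_clusterNode hx l
  have hcard : ∀ᶠ ε in 𝓝[>] 0, (S ε).card = n + 1 := by
    filter_upwards [hinj] with ε h
    rw [Finset.card_image_of_injective _ h, Finset.card_univ]
    simpa using hlsum
  have hmem : ∀ᶠ ε in 𝓝[>] 0, ∀ s ∈ S ε, (s = A ∨ c < s) ∧ (s = B ∨ s < d) := by
    filter_upwards [eventually_clusterNode_mem hc hd hlA hlB] with ε h s hs
    obtain ⟨q, -, rfl⟩ := Finset.mem_image.1 hs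
    exact h q
  have hprod : ∀ y, ∀ᶠ ε in 𝓝[>] 0, ∏ s ∈ S ε, (y - s) = ∏ q, (y - clusterNode x l ε q) := by
    intro y
    filter_upwards [hinj] with ε h
    exact Finset.prod_image h.injOn
  have hprod_lim : ∀ y, Tendsto (fun ε => ∏ s ∈ S ε, (y - s)) (𝓝[>] 0)
      (𝓝 (∏ j, (y - x j) ^ l j)) := fun y =>
    (tendsto_prod_sub_clusterNode x l y).congr' ((hprod y).mono fun _ h => h.symm)
  have hnotMem : ∀ y, (∀ j, y ≠ x j) → ∀ᶠ ε in 𝓝[>] 0, y ∉ S ε := by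
    intro y hy
    filter_upwards [(hprod_lim y).eventually_ne (Finset.prod_ne_zero_iff.2 fun j _ =>
      pow_ne_zero _ (sub_ne_zero.2 (hy j)))] with ε h hyS
    exact h (Finset.prod_eq_zero hyS (sub_self y))
  have hxS : ∀ j ε, x j ∈ S ε := by
    intro j ε
    exact Finset.mem_image.2 ⟨⟨j, ⟨0, hl j⟩⟩, Finset.mem_univ _, by simp [clusterNode]⟩
  obtain ⟨i⟩ := ‹Nonempty ι›
  have hbound : ∀ y ∈ Set.Ioo c d \ Set.range x, ∃ K : ℝ,
      ∀ᶠ ε in 𝓝[>] 0, |(P ε).eval y| ≤ K := by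
    rintro y ⟨⟨hcy, hyd⟩, hy⟩
    have hy' : ∀ j, y ≠ x j := fun j h => hy ⟨j, h.symm⟩
    set W := ∏ j, (y - x j) ^ l j with hW
    refine ⟨|f y| + (M + M) / |y - x i| * (|W| + 1), ?_⟩
    filter_upwards [hcard, hmem, hnotMem y hy',
      (hprod_lim y).abs.eventually_le_const (lt_add_one |W|)] with ε h₁ h₂ h₃ h₄
    have hyT : y ∉ (S ε).erase (x i) := fun h => h₃ (Finset.mem_of_mem_erase h)
    have hsub := finsetDivDiff_sub f hyT (Finset.notMem_erase (x i) (S ε)) (hy' i)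
    rw [Finset.insert_erase (hxS i ε)] at hsub
    have hD₁ := hM (S ε) h₁ h₂
    have hD₂ : |finsetDivDiff f (insert y ((S ε).erase (x i)))| ≤ M := by
      refine hM _ ?_ fun s hs => ?_
      · rw [Finset.card_insert_of_notMem hyT, Finset.card_erase_of_mem (hxS i ε), h₁]
        rfl
      · rcases Finset.mem_insert.1 hs with rfl | hs
        · exact ⟨Or.inr hcy, Or.inr hyd⟩
        · exact h₂ s (Finset.mem_of_mem_erase hs)
    have hpos : 0 < |y - x i| := abs_pos.2 (sub_ne_zero.2 (hy' i))
    have hD : |finsetDivDiff f (insert y (S ε))| ≤ (M + M) / |y - x i| := by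
      rw [le_div_iff₀ hpos, abs_sub_comm, mul_comm, ← abs_mul, ← hsub]
      exact (abs_sub _ _).trans (add_le_add hD₁ hD₂)
    have herr := sub_eval_interpolate f h₃
    have hPy : (P ε).eval y =
        f y - finsetDivDiff f (insert y (S ε)) * ∏ s ∈ S ε, (y - s) := by
      simp only [P]; linarith
    rw [hPy]
    refine (abs_sub _ _).trans (add_le_add le_rfl ?_)
    rw [abs_mul]
    exact mul_le_mul hD h₄ (abs_nonneg _) ((abs_nonneg _).trans hD)
  let F : Ultrafilter ℝ := Ultrafilter.of (𝓝[>] (0 : ℝ))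
  have hF : (F : Filter ℝ) ≤ 𝓝[>] 0 := Ultrafilter.of_le _
  have hPdeg : ∀ᶠ ε in 𝓝[>] 0, (P ε).natDegree ≤ n := by
    filter_upwards [hcard] with ε h using natDegree_interpolate_id_le f h
  obtain ⟨p, hpdeg, hp⟩ := exists_tendsto_eval_of_bounded F (hPdeg.filter_mono hF)
    ((Set.Ioo_infinite hcd).sdiff (Set.finite_range x)) fun y hy =>
      (hbound y hy).imp fun _ h => h.filter_mono hF
  refine ⟨p, hpdeg, fun j => ?_, fun y hyI hy => ?_⟩
  · refine tendsto_nhds_unique (hp (x j)) (tendsto_const_nhds.congr fun ε => ?_)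
    exact (eval_interpolate_id f (hxS j ε)).symm
  · refine ge_of_tendsto ((tendsto_const_nhds.sub (hp y)).mul ((hprod_lim y).mono_left hF)) ?_
    refine Eventually.filter_mono hF ?_
    filter_upwards [hcard, hmem, hnotMem y hy] with ε h₁ h₂ h₃
    have hSI : ∀ s ∈ S ε, s ∈ I := by
      intro s hs
      obtain ⟨hs₁, hs₂⟩ := h₂ s hs
      refine hI.out hA hB ⟨?_, ?_⟩
      · rcases hs₁ with h | h <;> linarith
      · rcases hs₂ with h | h <;> linarith
    have hD : 0 ≤ finsetDivDiff f (insert y (S ε)) := by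
      refine hf.finsetDivDiff_nonneg ?_ (by rw [Finset.card_insert_of_notMem h₃, h₁])
      rw [Finset.coe_insert]
      exact Set.insert_subset hyI hSI
    simp only [P]
    rw [sub_eval_interpolate f h₃, mul_assoc]
    exact mul_nonneg hD (mul_self_nonneg _)

/-- Theorem 1 (attaching method): for an `n`-convex function `f` on an interval `I`,
points `x₁ < … < x_k` of `I` with multiplicities `l₁ + … + l_k = n + 1`
(multiplicity `1` being required at a least/greatest element of `I`), there is a
polynomial `p ∈ Πₙ` interpolating `f` at the `x_j` and satisfying the alternating
sign conditions on the consecutive intervals determined by the `x_j`. -/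
theorem attaching_theorem
    (n k : ℕ) (hk1 : 1 ≤ k) (hkn : k ≤ n)
    (I : Set ℝ) (hI : I.OrdConnected)
    (f : ℝ → ℝ) (hf : NConvexOn n I f)
    (x : Fin k → ℝ) (hx : StrictMono x) (hxI : ∀ j, x j ∈ I)
    (l : Fin k → ℕ) (hl : ∀ j, 1 ≤ l j) (hlsum : ∑ j, l j = n + 1)
    (hleft : IsLeast I (x ⟨0, by omega⟩) → l ⟨0, by omega⟩ = 1)
    (hright : IsGreatest I (x ⟨k - 1, by omega⟩) → l ⟨k - 1, by omega⟩ = 1) :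
    ∃ p : Polynomial ℝ, p.natDegree ≤ n ∧
      (∀ j, p.eval (x j) = f (x j)) ∧
      (∀ y ∈ I, y < x ⟨0, by omega⟩ →
        0 ≤ (-1 : ℝ) ^ (n + 1) * (f y - p.eval y)) ∧
      (∀ j : Fin k, ∀ hj : j.val + 1 < k, ∀ y : ℝ,
        x j < y → y < x ⟨j.val + 1, hj⟩ →
        0 ≤ (-1 : ℝ) ^ (n + 1 - ∑ i ∈ Finset.Iic j, l i) * (f y - p.eval y)) ∧
      (∀ y ∈ I, x ⟨k - 1, by omega⟩ < y → 0 ≤ f y - p.eval y) := by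
  have hk0 : 0 < k := hk1
  have hmono : ∀ i j : Fin k, i ≤ j → x i ≤ x j := fun i j h => hx.monotone h
  have hfst : ∀ j : Fin k, x ⟨0, hk0⟩ ≤ x j := fun j =>
    hmono _ _ (Fin.mk_le_of_le_val (Nat.zero_le _))
  have hlst : ∀ j : Fin k, x j ≤ x ⟨k - 1, by omega⟩ := fun j =>
    hmono _ _ (Fin.le_def.2 (Nat.le_sub_one_of_lt j.isLt))
  obtain ⟨A, hA, hAx, hlA⟩ : ∃ A ∈ I, (∀ j, A ≤ x j) ∧ ∀ j, x j = A → l j = 1 := by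
    by_cases h : IsLeast I (x ⟨0, hk0⟩)
    · refine ⟨_, hxI _, hfst, fun j hj => ?_⟩
      rw [hx.injective hj]
      exact hleft h
    · obtain ⟨a, ha, hlt⟩ : ∃ a ∈ I, a < x ⟨0, hk0⟩ := by
        by_contra! hcon
        exact h ⟨hxI _, hcon⟩
      exact ⟨a, ha, fun j => hlt.le.trans (hfst j), fun j hj =>
        absurd hj (hlt.trans_le (hfst j)).ne'⟩
  obtain ⟨B, hB, hxB, hlB⟩ : ∃ B ∈ I, (∀ j, x j ≤ B) ∧ ∀ j, x j = B → l j = 1 := by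
    by_cases h : IsGreatest I (x ⟨k - 1, by omega⟩)
    · refine ⟨_, hxI _, hlst, fun j hj => ?_⟩
      rw [hx.injective hj]
      exact hright h
    · obtain ⟨b, hb, hlt⟩ : ∃ b ∈ I, x ⟨k - 1, by omega⟩ < b := by
        by_contra! hcon
        exact h ⟨hxI _, hcon⟩
      exact ⟨b, hb, fun j => (hlst j).trans hlt.le, fun j hj =>
        absurd hj ((hlst j).trans_lt hlt).ne⟩
  have hAB : A < B := by
    refine lt_of_le_of_ne ((hAx ⟨0, hk0⟩).trans (hxB _)) fun h => ?_
    have hone : ∀ j, l j = 1 := fun j => hlA j (le_antisymm (h ▸ hxB j) (hAx j))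
    simp only [hone, Finset.sum_const, Finset.card_univ, Fintype.card_fin] at hlsum
    simp at hlsum
    omega
  have : Nonempty (Fin k) := ⟨⟨0, hk0⟩⟩
  obtain ⟨p, hpdeg, hpx, hsign⟩ := hf.exists_attaching_polynomial hI hx.injective hl hlsum
    hA hB hAB hAx hxB hlA hlB
  have key : ∀ y ∈ I, (∀ j, y ≠ x j) →
      0 ≤ (-1 : ℝ) ^ (∑ j with y < x j, l j) * (f y - p.eval y) := by
    intro y hyI hy
    have h₁ := prod_sub_pow_sign x l hy
    have h₂ := hsign y hyI hy
    set e := (-1 : ℝ) ^ (∑ j with y < x j, l j) with he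
    have hee : e * e = 1 := by rw [he, ← mul_pow]; simp
    refine nonneg_of_mul_nonneg_left (b := e * ∏ j, (y - x j) ^ l j) ?_ h₁
    calc 0 ≤ (f y - p.eval y) * ∏ j, (y - x j) ^ l j := h₂
      _ = e * e * ((f y - p.eval y) * ∏ j, (y - x j) ^ l j) := by rw [hee, one_mul]
      _ = e * (f y - p.eval y) * (e * ∏ j, (y - x j) ^ l j) := by ring
  refine ⟨p, hpdeg, hpx, fun y hyI hy => ?_, fun j hj y hy₁ hy₂ => ?_, fun y hyI hy => ?_⟩
  · have hlt : ∀ j, y < x j := fun j => hy.trans_le (hfst j)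
    have h := key y hyI fun j => (hlt j).ne
    rwa [Finset.filter_true_of_mem fun j _ => hlt j, hlsum] at h
  · have hIic : ∀ i, i ≤ j → x i < y := fun i hi => (hmono i j hi).trans_lt hy₁
    have hIoi : ∀ i, ¬ i ≤ j → y < x i := fun i hi =>
      hy₂.trans_le (hmono _ i (Fin.le_def.2 (Nat.succ_le_of_lt (Fin.lt_def.1 (not_le.1 hi)))))
    have h := key y (hI.out (hxI j) (hxI _) ⟨hy₁.le, hy₂.le⟩) fun i => by
      by_cases hi : i ≤ j
      · exact (hIic i hi).ne'
      · exact (hIoi i hi).ne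
    have hfilter : (Finset.univ.filter fun i => y < x i) = Finset.univ \ Finset.Iic j := by
      ext i
      simp only [Finset.mem_filter, Finset.mem_univ, true_and, Finset.mem_sdiff, Finset.mem_Iic]
      exact ⟨fun hi hij => lt_asymm hi (hIic i hij), hIoi i⟩
    have hsum := Finset.sum_sdiff (f := l) (Finset.subset_univ (Finset.Iic j))
    rw [hfilter] at h
    rwa [← hlsum, ← hsum, Nat.add_sub_cancel]
  · have hlt : ∀ j, x j < y := fun j => (hlst j).trans_lt hy
    have h := key y hyI fun j => (hlt j).ne'
    rw [Finset.filter_false_of_mem fun j _ => (hlt j).not_gt] at h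
    simpa using h
end

section
/- Let n ∈ ℕ, n ≥ 1. If f : [a, b] → ℝ is (2n−1)-convex, x₁ = a, x₂ < … < x_n are points of the open interval (a, b), and x_{n+1} = b, then there exists a polynomial p ∈ Π_{2n−1} such that p(x_i) = f(x_i) for i = 1, …, n+1, and p(x) ≥ f(x) for all x ∈ [a, b]. -/
open Polynomial Finset in
/-- The divided difference over distinct points is the top coefficient of the Lagrange
interpolation polynomial. -/
theorem divDiff_eq_coeff_interpolate (f : ℝ → ℝ) (l : List ℝ) (hl : l.Nodup) :
    divDiff f l = (Lagrange.interpolate l.toFinset id f).coeff (l.length - 1) := by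
  induction l using divDiff.induct with
  | case1 => simp [divDiff]
  | case2 x => simp [divDiff]
  | case3 x y l ih₁ ih₂ =>
    set z := (y :: l).getLast (List.cons_ne_nil y l) with hz
    have hsplit : (x :: (y :: l).dropLast) ++ [z] = x :: y :: l := by
      rw [List.cons_append, List.dropLast_append_getLast]
    have hnd₁ : (y :: l).Nodup := hl.of_cons
    have hnd₂ : (x :: (y :: l).dropLast).Nodup := by
      rw [← hsplit] at hl
      exact hl.of_append_left
    have hzmem : z ∈ y :: l := List.getLast_mem _
    have hxz : x ≠ z := fun h => (List.nodup_cons.1 hl).1 (h ▸ hzmem)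
    have herx : (x :: y :: l).toFinset.erase x = (y :: l).toFinset := by
      rw [List.toFinset_cons, Finset.erase_insert]
      simpa using (List.nodup_cons.1 hl).1
    have herz : (x :: y :: l).toFinset.erase z = (x :: (y :: l).dropLast).toFinset := by
      have hzn : z ∉ x :: (y :: l).dropLast := by
        rw [← hsplit, List.nodup_append] at hl
        intro h
        exact hl.2.2 z h z (by simp) rfl
      rw [← hsplit, List.toFinset_append, List.toFinset_cons (a := z), List.toFinset_nil]
      ext t
      simp only [Finset.mem_erase, Finset.mem_union, List.mem_toFinset, Finset.mem_insert,
        Finset.notMem_empty, or_false]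
      constructor
      · rintro ⟨h, h' | h'⟩
        · exact h'
        · exact absurd h' h
      · intro h
        exact ⟨fun e => hzn (e ▸ h), Or.inl h⟩
    have key : ∀ (s : Finset ℝ) (c d : ℝ), #s = l.length + 1 →
        (Lagrange.interpolate s id f * Lagrange.basisDivisor c d).coeff (l.length + 1)
          = (c - d)⁻¹ * (Lagrange.interpolate s id f).coeff l.length := by
      intro s c d hs
      have h0 : (Lagrange.interpolate s id f).coeff (l.length + 1) = 0 := by
        apply coeff_eq_zero_of_degree_lt
        have := Lagrange.degree_interpolate_lt (s := s) (v := id) f (Set.injOn_id _)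
        rwa [hs] at this
      rw [Lagrange.basisDivisor, mul_left_comm, coeff_C_mul, mul_sub, coeff_sub, coeff_mul_X,
        coeff_mul_C, h0]
      ring
    rw [divDiff, ih₁ hnd₁, ih₂ hnd₂, ← hz,
      Lagrange.interpolate_eq_add_interpolate_erase (s := (x :: y :: l).toFinset) (i := x) (j := z)
        f (Set.injOn_id _) (by simp) (List.mem_toFinset.2 (List.mem_cons_of_mem _ hzmem)) hxz,
      herx, herz]
    have e₁ := key (y :: l).toFinset z x (by simpa using List.toFinset_card_of_nodup hnd₁)
    have e₂ := key (x :: (y :: l).dropLast).toFinset x z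
      (by simpa using List.toFinset_card_of_nodup hnd₂)
    simp only [List.length_cons, Nat.add_sub_cancel, List.length_dropLast, id] at e₁ e₂ ⊢
    rw [coeff_add, e₁, e₂]
    have h1 := sub_ne_zero.2 hxz
    have h2 := sub_ne_zero.2 hxz.symm
    field_simp
    ring

open Polynomial Finset in
/-- Newton's form of the interpolation error. -/
theorem sub_eval_interpolate_eq_coeff_mul_prod (f : ℝ → ℝ) (s : Finset ℝ) (y : ℝ) (hy : y ∉ s) :
    f y - (Lagrange.interpolate s id f).eval y =
      (Lagrange.interpolate (insert y s) id f).coeff #s * ∏ z ∈ s, (y - z) := by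
  set P := Lagrange.interpolate (insert y s) id f with hP
  have hPdeg : P.degree < ↑(#s + 1) := by
    have := Lagrange.degree_interpolate_lt (s := insert y s) (v := id) f (Set.injOn_id _)
    rwa [card_insert_of_notMem hy] at this
  have hPeval : ∀ z ∈ insert y s, P.eval z = f z := fun z hz =>
    Lagrange.eval_interpolate_at_node f (v := id) (Set.injOn_id _) hz
  have hmonic : (Lagrange.nodal s (id : ℝ → ℝ)).coeff #s = 1 := by
    have := (Lagrange.nodal_monic (s := s) (v := (id : ℝ → ℝ))).coeff_natDegree
    rwa [Lagrange.natDegree_nodal] at this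
  have h : P - C (P.coeff #s) * Lagrange.nodal s id = Lagrange.interpolate s id f := by
    refine Lagrange.eq_interpolate_of_eval_eq _ (Set.injOn_id _) ?_ fun z hz => ?_
    · rw [degree_lt_iff_coeff_zero]
      intro m hm
      rw [coeff_sub, coeff_C_mul]
      rcases hm.eq_or_lt with rfl | hm
      · rw [hmonic]; ring
      · rw [coeff_eq_zero_of_degree_lt (hPdeg.trans_le (by exact_mod_cast hm)),
          coeff_eq_zero_of_degree_lt (p := Lagrange.nodal s id)
            (by rw [Lagrange.degree_nodal]; exact_mod_cast hm)]
        ring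
    · have := Lagrange.eval_nodal_at_node (v := (id : ℝ → ℝ)) hz
      simp only [id] at this ⊢
      simp [this, hPeval z (mem_insert_of_mem hz)]
  rw [← h, eval_sub, hPeval y (mem_insert_self _ _), eval_mul, eval_C, Lagrange.eval_nodal]
  simp

open Polynomial Finset in
theorem NConvexOn.sub_eval_interpolate_mul_prod_nonneg {k : ℕ} {I : Set ℝ} {f : ℝ → ℝ}
    (hf : NConvexOn k I f) {s : Finset ℝ} (hs : #s = k + 1) (hsI : ∀ z ∈ s, z ∈ I)
    {y : ℝ} (hy : y ∈ I) :
    0 ≤ (f y - (Lagrange.interpolate s id f).eval y) * ∏ z ∈ s, (y - z) := by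
  by_cases hys : y ∈ s
  · rw [prod_eq_zero hys (sub_self y), mul_zero]
  rw [sub_eval_interpolate_eq_coeff_mul_prod f s y hys, mul_assoc]
  refine mul_nonneg ?_ (mul_self_nonneg _)
  have hcard : (insert y s).toList.length = k + 2 := by
    rw [length_toList, card_insert_of_notMem hys, hs]
  have h := hf (insert y s).toList hcard (nodup_toList _) (by simpa using ⟨hy, hsI⟩)
  rw [divDiff_eq_coeff_interpolate f _ (nodup_toList _), toList_toFinset, hcard] at h
  rwa [hs]

open Polynomial in
/-- The interpolation error of `f` at the nodes `X`, divided by the nodal polynomial of `X`. -/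
noncomputable def interpQuot (f : ℝ → ℝ) (X : Finset ℝ) (z : ℝ) : ℝ :=
  (f z - (Lagrange.interpolate X id f).eval z) / (Lagrange.nodal X id).eval z

open Polynomial Finset in
theorem eval_nodal_id_ne_zero {X : Finset ℝ} {y : ℝ} (hy : y ∉ X) :
    (Lagrange.nodal X id).eval y ≠ 0 :=
  Lagrange.eval_nodal_not_at_node fun _ hz h => hy (h ▸ hz)

open Polynomial Finset in
theorem interpQuot_mul_eval_nodal (f : ℝ → ℝ) {X : Finset ℝ} {y : ℝ} (hy : y ∉ X) :
    interpQuot f X y * (Lagrange.nodal X id).eval y =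
      f y - (Lagrange.interpolate X id f).eval y :=
  div_mul_cancel₀ _ (eval_nodal_id_ne_zero hy)

open Polynomial Finset in
theorem degree_interpolate_add_nodal_mul_lt (f c : ℝ → ℝ) (X T : Finset ℝ) :
    (Lagrange.interpolate X id f + Lagrange.nodal X id * Lagrange.interpolate T id c).degree <
      ↑(#X + #T) := by
  have hL := Lagrange.degree_interpolate_lt (s := X) (v := id) f (Set.injOn_id _)
  have hq := Lagrange.degree_interpolate_lt (s := T) (v := id) c (Set.injOn_id _)
  refine (degree_add_le _ _).trans_lt
    (max_lt (hL.trans_le (by exact_mod_cast Nat.le_add_right _ _)) ?_)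
  rw [degree_mul, Lagrange.degree_nodal, Nat.cast_add]
  exact WithBot.add_lt_add_left (WithBot.natCast_ne_bot _) hq

open Polynomial Finset in
theorem interpolate_union_eq (f : ℝ → ℝ) {X T : Finset ℝ} (hXT : Disjoint X T) :
    Lagrange.interpolate (X ∪ T) id f = Lagrange.interpolate X id f +
      Lagrange.nodal X id * Lagrange.interpolate T id (interpQuot f X) := by
  symm
  refine Lagrange.eq_interpolate_of_eval_eq _ (Set.injOn_id _) ?_ fun z hz => ?_
  · rw [card_union_of_disjoint hXT]
    exact degree_interpolate_add_nodal_mul_lt _ _ _ _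
  · rw [eval_add, eval_mul]
    by_cases hzX : z ∈ X
    · rw [Lagrange.eval_nodal_at_node hzX, zero_mul, add_zero,
        Lagrange.eval_interpolate_at_node f (Set.injOn_id _) hzX]
    · have hzT : z ∈ T := (mem_union.1 hz).resolve_left hzX
      rw [Lagrange.eval_interpolate_at_node _ (Set.injOn_id _) hzT]
      have := interpQuot_mul_eval_nodal f hzX
      simp only [id] at this ⊢
      linarith

open Polynomial Finset in
theorem NConvexOn.interpQuot_sub_mul_prod_nonneg {k : ℕ} {I : Set ℝ} {f : ℝ → ℝ}
    (hf : NConvexOn k I f) {X T : Finset ℝ} (hXT : Disjoint X T) (hcard : #X + #T = k + 1)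
    (hX : ∀ z ∈ X, z ∈ I) (hT : ∀ z ∈ T, z ∈ I) {y : ℝ} (hy : y ∈ I) (hyX : y ∉ X) :
    0 ≤ (interpQuot f X y - (Lagrange.interpolate T id (interpQuot f X)).eval y) *
      ∏ z ∈ T, (y - z) := by
  have h := hf.sub_eval_interpolate_mul_prod_nonneg (s := X ∪ T)
    (by rw [card_union_of_disjoint hXT, hcard])
    (fun z hz => (mem_union.1 hz).elim (hX z) (hT z)) hy
  have hw := eval_nodal_id_ne_zero hyX
  have hprod : ∏ z ∈ X, (y - z) = (Lagrange.nodal X id).eval y := by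
    rw [Lagrange.eval_nodal]; rfl
  have hq := interpQuot_mul_eval_nodal f hyX
  rw [interpolate_union_eq f hXT, prod_union hXT, hprod, eval_add, eval_mul, ← sub_sub, ← hq] at h
  refine nonneg_of_mul_nonneg_left (b := (Lagrange.nodal X id).eval y ^ 2) ?_ (by positivity)
  exact h.trans_eq (by ring)

open Filter Topology in
theorem eventually_nhdsGT_notMem (X : Finset ℝ) (x₀ : ℝ) : ∀ᶠ y in 𝓝[>] x₀, y ∉ X := by
  have : ∀ᶠ y in 𝓝[>] x₀, ∀ z ∈ X, y ≠ z := by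
    rw [Filter.eventually_all_finset]
    intro z _
    by_cases h : x₀ = z
    · filter_upwards [self_mem_nhdsWithin] with y hy
      exact h ▸ (ne_of_gt hy)
    · exact (eventually_ne_nhds h).filter_mono nhdsWithin_le_nhds
  filter_upwards [this] with y hy hyX
  exact hy y hyX rfl

open Polynomial Finset Filter Topology in
theorem NConvexOn.eventually_abs_interpQuot_le {k m : ℕ} {a b : ℝ} {f : ℝ → ℝ}
    (hf : NConvexOn k (Set.Icc a b) f) {X : Finset ℝ} (hX : ∀ z ∈ X, z ∈ Set.Icc a b)
    (hcard : #X + (m + 1) = k + 1) {x₀ : ℝ} (hx₀ : x₀ ∈ Set.Ioo a b) :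
    ∃ M, ∀ᶠ y in 𝓝[>] x₀, |interpQuot f X y| ≤ M := by
  obtain ⟨T, hTsub, hTcard⟩ :=
    ((Set.Ioo_infinite hx₀.2).sdiff X.finite_toSet).exists_subset_card_eq (m + 1)
  obtain ⟨s, hs, hsX⟩ := ((Set.Ioo_infinite hx₀.1).sdiff X.finite_toSet).nonempty
  obtain ⟨t, ht⟩ : T.Nonempty := card_pos.1 (by omega)
  have hT : ∀ z ∈ T, z ∈ Set.Ioo x₀ b ∧ z ∉ X := fun z hz => hTsub hz
  have hsT : s ∉ T.erase t := fun h =>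
    (hs.2.trans (hT s (mem_of_mem_erase h)).1.1).false
  set T' := insert s (T.erase t) with hT'
  have hT'card : #T' = m + 1 := by
    rw [hT', card_insert_of_notMem hsT, card_erase_of_mem ht, hTcard]; rfl
  have hTI : ∀ z ∈ T, z ∈ Set.Icc a b := fun z hz =>
    ⟨(hx₀.1.trans (hT z hz).1.1).le, (hT z hz).1.2.le⟩
  have hT'I : ∀ z ∈ T', z ∈ Set.Icc a b := by
    intro z hz
    rcases mem_insert.1 hz with rfl | hz
    · exact ⟨hs.1.le, (hs.2.trans hx₀.2).le⟩
    · exact hTI z (mem_of_mem_erase hz)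
  have hdT : Disjoint X T := disjoint_right.2 fun z hz => (hT z hz).2
  have hdT' : Disjoint X T' := disjoint_right.2 fun z hz => by
    rcases mem_insert.1 hz with rfl | hz
    · exact hsX
    · exact (hT z (mem_of_mem_erase hz)).2
  set P := Lagrange.interpolate T id (interpQuot f X)
  set Q := Lagrange.interpolate T' id (interpQuot f X)
  refine ⟨|P.eval x₀| + |Q.eval x₀| + 1, ?_⟩
  have hcont : Continuous fun y => |P.eval y| + |Q.eval y| := by fun_prop
  have hlt : ∀ᶠ y in 𝓝[>] x₀, |P.eval y| + |Q.eval y| < |P.eval x₀| + |Q.eval x₀| + 1 :=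
    (hcont.continuousAt.eventually_lt continuousAt_const (lt_add_one _)).filter_mono
      nhdsWithin_le_nhds
  have hsmall : ∀ᶠ y in 𝓝[>] x₀, ∀ z ∈ T, y < z := by
    rw [eventually_all_finset]
    intro z hz
    exact (eventually_lt_nhds (hT z hz).1.1).filter_mono nhdsWithin_le_nhds
  filter_upwards [hlt, hsmall, eventually_nhdsGT_notMem X x₀, self_mem_nhdsWithin]
    with y hy hyT hyX hxy
  have hxy : x₀ < y := hxy
  have hyI : y ∈ Set.Icc a b := ⟨(hx₀.1.trans hxy).le, (hyT t ht).le.trans (hT t ht).1.2.le⟩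
  have h₁ := hf.interpQuot_sub_mul_prod_nonneg hdT (by omega) hX hTI hyI hyX
  have h₂ := hf.interpQuot_sub_mul_prod_nonneg hdT' (by omega) hX hT'I hyI hyX
  rw [← mul_prod_erase T (fun z => y - z) ht, ← mul_assoc] at h₁
  rw [hT', prod_insert hsT, ← mul_assoc] at h₂
  set R := ∏ z ∈ T.erase t, (y - z) with hR
  have hRne : R ≠ 0 := prod_ne_zero_iff.2 fun z hz =>
    (sub_neg.2 (hyT z (mem_of_mem_erase hz))).ne
  have hyt : y - t < 0 := sub_neg.2 (hyT t ht)
  have hys : 0 < y - s := sub_pos.2 (hs.2.trans hxy)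
  change 0 ≤ (interpQuot f X y - P.eval y) * (y - t) * R at h₁
  change 0 ≤ (interpQuot f X y - Q.eval y) * (y - s) * R at h₂
  have hP := neg_abs_le (P.eval y)
  have hP' := le_abs_self (P.eval y)
  have hQ := neg_abs_le (Q.eval y)
  have hQ' := le_abs_self (Q.eval y)
  refine le_trans ?_ hy.le
  rw [abs_le]
  rcases hRne.lt_or_gt with hR0 | hR0
  · have h₁' := nonpos_of_mul_nonneg_left h₁ hR0
    have h₂' := nonpos_of_mul_nonneg_left h₂ hR0
    have h₁'' := nonneg_of_mul_nonpos_left h₁' hyt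
    have h₂'' := nonpos_of_mul_nonpos_left h₂' hys
    constructor <;> linarith
  · have h₁' := nonneg_of_mul_nonneg_left h₁ hR0
    have h₂' := nonneg_of_mul_nonneg_left h₂ hR0
    have h₁'' := nonpos_of_mul_nonneg_left h₁' hyt
    have h₂'' := nonneg_of_mul_nonneg_left h₂' hys
    constructor <;> linarith

open Polynomial Finset in
theorem interpolate_image_id {J : Finset ℝ} {v : ℝ → ℝ} (hv : Set.InjOn v J) (g : ℝ → ℝ) :
    Lagrange.interpolate (J.image v) id g = Lagrange.interpolate J v (g ∘ v) := by
  refine Lagrange.eq_interpolate_of_eval_eq _ hv ?_ fun z hz => ?_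
  · rw [← card_image_of_injOn hv]
    exact Lagrange.degree_interpolate_lt g (Set.injOn_id _)
  · exact Lagrange.eval_interpolate_at_node g (v := id) (Set.injOn_id _) (mem_image_of_mem v hz)

open Polynomial Finset Filter Topology in
theorem tendsto_eval_interpolate {F : Type*} {l : Filter F} {J : Finset ℝ} {v r : F → ℝ → ℝ}
    {v₀ c : ℝ → ℝ} (hv₀ : Set.InjOn v₀ J) (hv : ∀ z ∈ J, Tendsto (v · z) l (𝓝 (v₀ z)))
    (hr : ∀ z ∈ J, Tendsto (r · z) l (𝓝 (c z))) (y : ℝ) :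
    Tendsto (fun e => (Lagrange.interpolate J (v e) (r e)).eval y) l
      (𝓝 ((Lagrange.interpolate J v₀ c).eval y)) := by
  simp only [Lagrange.interpolate_apply, Lagrange.basis, Lagrange.basisDivisor, eval_finsetSum,
    eval_mul, eval_C, eval_prod, eval_sub, eval_X]
  refine tendsto_finsetSum _ fun z hz => (hr z hz).mul (tendsto_finsetProd _ fun u hu => ?_)
  have hu' := mem_of_mem_erase hu
  refine (((hv z hz).sub (hv u hu')).inv₀ ?_).mul (tendsto_const_nhds.sub (hv u hu'))
  exact sub_ne_zero.2 fun h => ne_of_mem_erase hu (hv₀ hz hu' h).symm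

open Polynomial Finset Filter Topology in
/-- Among the polynomials of degree less than `#J`, one interpolates one-sided cluster values of
`interpQuot f X` at the nodes `J`, and inherits the sign of the interpolation error. -/
theorem NConvexOn.exists_interpQuot_sub_mul_prod_nonneg {k : ℕ} {a b : ℝ} {f : ℝ → ℝ}
    (hf : NConvexOn k (Set.Icc a b) f) {X J : Finset ℝ} (hX : ∀ z ∈ X, z ∈ Set.Icc a b)
    (hJ : ∀ z ∈ J, z ∈ Set.Ioo a b) (hcard : #X + #J = k + 1) :
    ∃ c : ℝ → ℝ, ∀ y ∈ Set.Icc a b, y ∉ X →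
      0 ≤ (interpQuot f X y - (Lagrange.interpolate J id c).eval y) * ∏ z ∈ J, (y - z) := by
  let U : Ultrafilter ℝ := Ultrafilter.of (𝓝[>] 0)
  have hU : (U : Filter ℝ) ≤ 𝓝[>] 0 := Ultrafilter.of_le _
  have hshift : ∀ z : ℝ, Tendsto (fun e => z + e) U (𝓝[>] z) := by
    intro z
    refine Tendsto.mono_left ?_ hU
    refine tendsto_nhdsWithin_iff.2 ⟨?_, ?_⟩
    · have : Tendsto (fun e : ℝ => z + e) (𝓝 0) (𝓝 (z + 0)) :=
        (continuous_const.add continuous_id).tendsto 0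
      rw [add_zero] at this
      exact this.mono_left nhdsWithin_le_nhds
    · filter_upwards [self_mem_nhdsWithin] with e he
      exact lt_add_of_pos_right z he
  have hlim : ∀ z, ∃ c, z ∈ J → Tendsto (fun e => interpQuot f X (z + e)) U (𝓝 c) := by
    intro z
    by_cases hz : z ∈ J
    · obtain ⟨m, hm⟩ : ∃ m, #J = m + 1 := Nat.exists_eq_succ_of_ne_zero (card_ne_zero_of_mem hz)
      obtain ⟨M, hM⟩ := hf.eventually_abs_interpQuot_le hX (m := m) (by omega) (hJ z hz)
      have hmem : ∀ᶠ e in U, interpQuot f X (z + e) ∈ Set.Icc (-M) M := by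
        filter_upwards [(hshift z).eventually hM] with e he
        exact abs_le.1 he
      obtain ⟨c, -, hc⟩ := isCompact_Icc.ultrafilter_le_nhds
        (U.map fun e => interpQuot f X (z + e)) (le_principal_iff.2 hmem)
      exact ⟨c, fun _ => hc⟩
    · exact ⟨0, fun h => absurd h hz⟩
  choose c hc using hlim
  refine ⟨c, fun y hy hyX => ?_⟩
  have hv : ∀ z : ℝ, Tendsto (fun e => z + e) U (𝓝 z) := fun z =>
    (hshift z).mono_right nhdsWithin_le_nhds
  refine ge_of_tendsto ((tendsto_const_nhds.sub (tendsto_eval_interpolate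
    (v := fun e z => z + e) (r := fun e z => interpQuot f X (z + e))
    (Set.injOn_id _) (fun z _ => hv z) hc y)).mul
      (tendsto_finsetProd J fun z _ => tendsto_const_nhds.sub (hv z))) ?_
  have hXe : ∀ᶠ e in (U : Filter ℝ), ∀ z ∈ J, z + e ∉ X := by
    rw [eventually_all_finset]
    exact fun z _ => (hshift z).eventually (eventually_nhdsGT_notMem X z)
  have hIe : ∀ᶠ e in (U : Filter ℝ), ∀ z ∈ J, z + e ∈ Set.Icc a b := by
    rw [eventually_all_finset]
    exact fun z hz => (hv z).eventually (Icc_mem_nhds (hJ z hz).1 (hJ z hz).2)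
  filter_upwards [hXe, hIe] with e heX heI
  have hinj : Function.Injective fun z : ℝ => z + e := add_left_injective e
  have h := hf.interpQuot_sub_mul_prod_nonneg (X := X) (T := J.image fun z => z + e)
    (disjoint_right.2 (forall_mem_image.2 heX))
    (by rw [card_image_of_injective _ hinj, hcard]) hX (forall_mem_image.2 heI) hy hyX
  rw [interpolate_image_id hinj.injOn, prod_image hinj.injOn] at h
  exact h

/-- Corollary 3: a `(2n−1)`-convex function on `[a, b]` is bounded above,
at `n−1` prescribed interior points together with both endpoints, by an
interpolating polynomial of degree at most `2n−1`. -/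
theorem support_above_endpoints_nodes
    (n : ℕ) (hn : 1 ≤ n) (a b : ℝ) (f : ℝ → ℝ)
    (hf : NConvexOn (2 * n - 1) (Set.Icc a b) f)
    (x : Fin (n + 1) → ℝ) (hx : StrictMono x)
    (hxa : x ⟨0, by omega⟩ = a) (hxb : x ⟨n, by omega⟩ = b)
    (hxI : ∀ i : Fin (n + 1), 0 < i.val → i.val < n → x i ∈ Set.Ioo a b) :
    ∃ p : Polynomial ℝ, p.natDegree ≤ 2 * n - 1 ∧
      (∀ i, p.eval (x i) = f (x i)) ∧
      ∀ y ∈ Set.Icc a b, f y ≤ p.eval y := by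
  classical
  set X : Finset ℝ := Finset.univ.image x with hXdef
  have hxX : ∀ i, x i ∈ X := fun i => Finset.mem_image_of_mem x (Finset.mem_univ i)
  have haX : a ∈ X := hxa ▸ hxX _
  have hbX : b ∈ X := hxb ▸ hxX _
  have hab : a < b := by
    rw [← hxa, ← hxb]
    exact hx (Fin.mk_lt_mk.2 hn)
  have hXcard : X.card = n + 1 := by
    rw [hXdef, Finset.card_image_of_injective _ hx.injective, Finset.card_univ, Fintype.card_fin]
  set J := (X.erase a).erase b with hJdef
  have hbXa : b ∈ X.erase a := Finset.mem_erase.2 ⟨hab.ne', hbX⟩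
  have hJcard : J.card = n - 1 := by
    rw [hJdef, Finset.card_erase_of_mem hbXa, Finset.card_erase_of_mem haX, hXcard]
    rfl
  have hJ : ∀ z ∈ J, z ∈ Set.Ioo a b := by
    intro z hz
    obtain ⟨hzb, hz⟩ := Finset.mem_erase.1 hz
    obtain ⟨hza, hz⟩ := Finset.mem_erase.1 hz
    obtain ⟨i, -, rfl⟩ := Finset.mem_image.1 hz
    refine hxI i (Nat.pos_of_ne_zero fun h => hza ?_) (lt_of_le_of_ne (by omega) fun h => hzb ?_)
    · rw [← hxa]; exact congrArg x (Fin.ext h)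
    · rw [← hxb]; exact congrArg x (Fin.ext h)
  have hX : ∀ z ∈ X, z ∈ Set.Icc a b := by
    intro z hz
    by_cases hza : z = a
    · rw [hza]; exact Set.left_mem_Icc.2 hab.le
    by_cases hzb : z = b
    · rw [hzb]; exact Set.right_mem_Icc.2 hab.le
    · exact Set.Ioo_subset_Icc_self
        (hJ z (Finset.mem_erase.2 ⟨hzb, Finset.mem_erase.2 ⟨hza, hz⟩⟩))
  obtain ⟨c, hc⟩ := hf.exists_interpQuot_sub_mul_prod_nonneg hX hJ (by omega)
  set p := Lagrange.interpolate X id f + Lagrange.nodal X id * Lagrange.interpolate J id c with hp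
  have hpX : ∀ z ∈ X, p.eval z = f z := by
    intro z hz
    have h₁ := Lagrange.eval_nodal_at_node (v := (id : ℝ → ℝ)) hz
    have h₂ := Lagrange.eval_interpolate_at_node f (v := id) (Set.injOn_id _) hz
    simp only [id] at h₁ h₂
    rw [hp, Polynomial.eval_add, Polynomial.eval_mul, h₁, h₂, zero_mul, add_zero]
  refine ⟨p, ?_, fun i => hpX _ (hxX i), fun y hy => ?_⟩
  · rw [Polynomial.natDegree_le_iff_coeff_eq_zero]
    intro N hN
    exact Polynomial.coeff_eq_zero_of_degree_lt
      ((degree_interpolate_add_nodal_mul_lt f c X J).trans_le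
        (by exact_mod_cast (by omega : X.card + J.card ≤ N)))
  · by_cases hyX : y ∈ X
    · exact (hpX y hyX).ge
    have hq := interpQuot_mul_eval_nodal f hyX
    have hnodal : (Lagrange.nodal X id).eval y = (y - a) * ((y - b) * ∏ z ∈ J, (y - z)) := by
      rw [Lagrange.eval_nodal, hJdef, Finset.mul_prod_erase _ (fun z => y - z) hbXa,
        Finset.mul_prod_erase _ (fun z => y - z) haX]
      rfl
    have hends : (y - a) * (y - b) ≤ 0 :=
      mul_nonpos_of_nonneg_of_nonpos (sub_nonneg.2 hy.1) (sub_nonpos.2 hy.2)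
    have hsign := mul_nonpos_of_nonneg_of_nonpos (hc y hy hyX) hends
    rw [hp, Polynomial.eval_add, Polynomial.eval_mul]
    rw [hnodal] at hq ⊢
    linarith
end
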